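/- Let (A, ∘) be a finite-dimensional Novikov algebra, (V, l, r) a finite-dimensional bimodule of (A, ∘), and Ã := A ⋉_{l⋆*, −r*} V* the semidirect product Novikov algebra, where l⋆ := l + r. Let α, β : V → A be linear maps and define α̃₋, β̃₊ : Ã* → Ã on Ã* ≅ V ⊕ A* by α̃₋(u + a*) := α(u) − α*(a*) and β̃₊(u + a*) := β(u) + β*(a*), where α*, β* : A* → V* are the dual maps. Suppose β̃₊ is a balanced Ã-bimodule homomorphism from (Ã*, L_{Ã,⋆}*, −R_Ã*) to (Ã, L_Ã, R_Ã). Then, for κ ∈ k, α satisfies α(u)∘α(v) − α(l(α(u))v + r(α(v))u) = κ β(u)∘β(v) for all u, v ∈ V if and only if α̃₋ satisfies α̃₋(ξ)•α̃₋(η) − α̃₋(L_{Ã,⋆}*(α̃₋(ξ))η − R_Ã*(α̃₋(η))ξ) = κ β̃₊(ξ)•β̃₊(η) for all ξ, η ∈ Ã*, where • is the product of Ã. -/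

import Mathlib

open TensorProduct


section Defs

variable {k : Type*} [Field k] [CharZero k]
variable {A : Type*} [AddCommGroup A] [Module k A]
variable {M : Type*} [AddCommGroup M] [Module k M]

/-- A bilinear operation satisfying the Novikov algebra axioms. -/
def IsNovikov (mul : A →ₗ[k] A →ₗ[k] A) : Prop :=
  (∀ a b c : A, mul (mul a b) c - mul a (mul b c) = mul (mul b a) c - mul b (mul a c)) ∧
  (∀ a b c : A, mul (mul a b) c = mul (mul a c) b)

/-- `(M, l, r)` is a bimodule of the Novikov algebra `(A, mul)`. -/
def IsNovikovBimodule (mul : A →ₗ[k] A →ₗ[k] A)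
    (l r : A →ₗ[k] Module.End k M) : Prop :=
  (∀ (a b : A) (v : M), l (mul a b - mul b a) v = l a (l b v) - l b (l a v)) ∧
  (∀ (a b : A) (v : M), l a (r b v) - r b (l a v) = r (mul a b) v - r b (r a v)) ∧
  (∀ (a b : A) (v : M), l (mul a b) v = r b (l a v)) ∧
  (∀ (a b : A) (v : M), r a (r b v) = r b (r a v))

/-- `(M, mulM, l, r)` is an `A`-bimodule Novikov algebra over the Novikov algebra `(A, mulA)`. -/
def IsBimoduleNovikovAlgebra (mulA : A →ₗ[k] A →ₗ[k] A)
    (mulM : M →ₗ[k] M →ₗ[k] M) (l r : A →ₗ[k] Module.End k M) : Prop :=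
  IsNovikov mulM ∧ IsNovikovBimodule mulA l r ∧
  (∀ (a : A) (v w : M), mulM (l a v) w - l a (mulM v w) = mulM (r a v) w - mulM v (l a w)) ∧
  (∀ (a : A) (v w : M), r a (mulM v w) - mulM v (r a w) = r a (mulM w v) - mulM w (r a v)) ∧
  (∀ (a : A) (v w : M), mulM (l a v) w = mulM (l a w) v) ∧
  (∀ (a : A) (v w : M), r a (mulM v w) = mulM (r a v) w)

/-- O-operator of weight `lam` on `(A, mulA)` associated to the A-bimodule Novikov algebra
`(M, mulM, l, r)`. -/
def IsOOperator (mulA : A →ₗ[k] A →ₗ[k] A) (mulM : M →ₗ[k] M →ₗ[k] M)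
    (l r : A →ₗ[k] Module.End k M) (lam : k) (α : M →ₗ[k] A) : Prop :=
  ∀ u v : M, mulA (α u) (α v) = α (l (α u) v + r (α v) u + lam • mulM u v)

/-- Post-Novikov algebra axioms: `circ` is Novikov and the eight compatibility conditions hold,
where `lhd a b = a ◁ b` and `rhd a b = a ▷ b`. -/
def IsPostNovikov (circ lhd rhd : A →ₗ[k] A →ₗ[k] A) : Prop :=
  IsNovikov circ ∧
  (∀ a b c : A, lhd (rhd a c) b = rhd (rhd a b + lhd a b + circ a b) c) ∧
  (∀ a b c : A, rhd a (lhd c b) - lhd (rhd a c) b + lhd (lhd c a) b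
      = lhd c (lhd a b + rhd a b + circ a b)) ∧
  (∀ a b c : A, rhd (rhd a b + lhd a b + circ a b) c - rhd (rhd b a + lhd b a + circ b a) c
      = rhd a (rhd b c) - rhd b (rhd a c)) ∧
  (∀ a b c : A, lhd (lhd a b) c = lhd (lhd a c) b) ∧
  (∀ a b c : A, circ (rhd a b) c - rhd a (circ b c) = circ (lhd b a) c - circ b (rhd a c)) ∧
  (∀ a b c : A, lhd (circ b c) a - circ b (lhd c a) = lhd (circ c b) a - circ c (lhd b a)) ∧
  (∀ a b c : A, circ (rhd a b) c = circ (rhd a c) b) ∧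
  (∀ a b c : A, lhd (circ a b) c = circ (lhd a c) b)

/-- Rota-Baxter operator of weight `lam` on the Novikov algebra `(A, mulA)`. -/
def IsRotaBaxter (mulA : A →ₗ[k] A →ₗ[k] A) (lam : k) (T : A →ₗ[k] A) : Prop :=
  ∀ x y : A, mulA (T x) (T y) = T (mulA (T x) y + mulA x (T y) + lam • mulA x y)

/-- `β : M → A` is balanced. -/
def IsBalanced (l r : A →ₗ[k] Module.End k M) (β : M →ₗ[k] A) : Prop :=
  ∀ u v : M, l (β u) v = r (β v) u

/-- `β : M → A` is A-invariant of mass `κ`. -/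
def IsAInvariant (mulA : A →ₗ[k] A →ₗ[k] A) (l r : A →ₗ[k] Module.End k M)
    (κ : k) (β : M →ₗ[k] A) : Prop :=
  (∀ (x : A) (u : M), κ • mulA x (β u) = κ • β (l x u)) ∧
  (∀ (x : A) (u : M), κ • mulA (β u) x = κ • β (r x u))

/-- `β : M → A` is equivalent of mass `μ`. -/
def IsEquivalentOfMass (mulM : M →ₗ[k] M →ₗ[k] M) (l r : A →ₗ[k] Module.End k M)
    (μ : k) (β : M →ₗ[k] A) : Prop :=
  (∀ u v w : M, μ • l (β (mulM u v)) w = μ • mulM (l (β u) v) w) ∧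
  (∀ u v w : M, μ • r (β (mulM v w)) u = μ • mulM u (r (β w) v))

/-- `β : M → A` is an A-bimodule homomorphism from `(M, l, r)` to `(A, L_A, R_A)`. -/
def IsBimoduleHom (mulA : A →ₗ[k] A →ₗ[k] A) (l r : A →ₗ[k] Module.End k M)
    (β : M →ₗ[k] A) : Prop :=
  (∀ (x : A) (u : M), β (l x u) = mulA x (β u)) ∧
  (∀ (x : A) (u : M), β (r x u) = mulA (β u) x)

/-- Extended O-operator of weight `lam` with extension `β` of mass `(κ, μ)`. -/
def IsExtendedOOperator (mulA : A →ₗ[k] A →ₗ[k] A) (mulM : M →ₗ[k] M →ₗ[k] M)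
    (l r : A →ₗ[k] Module.End k M) (lam κ μ : k) (α β : M →ₗ[k] A) : Prop :=
  IsBalanced l r β ∧ IsAInvariant mulA l r κ β ∧ IsEquivalentOfMass mulM l r μ β ∧
  ∀ u v : M, mulA (α u) (α v) - α (l (α u) v + r (α v) u + lam • mulM u v)
    = κ • mulA (β u) (β v) + μ • β (mulM u v)

end Defs

section DualDefs
variable {k : Type*} [Field k] [CharZero k]
variable {A : Type*} [AddCommGroup A] [Module k A]
variable {M : Type*} [AddCommGroup M] [Module k M]

/-- The dual representation `φ*` of `φ : A → End M`, with `⟨φ*(a) f, v⟩ = −⟨f, φ(a) v⟩`. -/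
noncomputable def dualRep (φ : A →ₗ[k] Module.End k M) :
    A →ₗ[k] Module.End k (Module.Dual k M) :=
  (Module.Dual.transpose (R := k)) ∘ₗ (-φ)


/-- The negative `−φ*` of the dual representation, i.e. `a ↦ (f ↦ f ∘ φ(a))`;
for `φ = R` this is the action `−R*`. -/
noncomputable def negDualRep (φ : A →ₗ[k] Module.End k M) :
    A →ₗ[k] Module.End k (Module.Dual k M) :=
  (Module.Dual.transpose (R := k)) ∘ₗ φ

/-- The linear map `A ⊗ A → Hom(A*, A)`, `x ⊗ y ↦ (f ↦ f(x) • y)`, sending `r` to `r̂`. -/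
noncomputable def hatMap : A ⊗[k] A →ₗ[k] (Module.Dual k A →ₗ[k] A) :=
  TensorProduct.lift
    (LinearMap.mk₂ k (fun x y => LinearMap.smulRight (Module.Dual.eval k A x) y)
      (fun x x' y => by
        ext f
        simp only [LinearMap.smulRight_apply, Module.Dual.eval_apply, LinearMap.add_apply,
          map_add, add_smul])
      (fun c x y => by
        ext f
        simp only [LinearMap.smulRight_apply, Module.Dual.eval_apply, LinearMap.smul_apply,
          map_smul, smul_assoc])
      (fun x y y' => by
        ext f
        simp only [LinearMap.smulRight_apply, Module.Dual.eval_apply, LinearMap.add_apply,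
          smul_add])
      (fun c x y => by
        ext f
        exact smul_comm _ _ _))

/-- `s ∈ A ⊗ A` is invariant: `(L(x) ⊗ id + id ⊗ L⋆(x)) s = 0` for all `x ∈ A`. -/
def IsInvariantTensor (mulA : A →ₗ[k] A →ₗ[k] A) (s : A ⊗[k] A) : Prop :=
  ∀ x : A, TensorProduct.map (mulA x) LinearMap.id s
      + TensorProduct.map LinearMap.id ((mulA + mulA.flip) x) s = 0

/-- The bilinear operation sending `(r, r')` to `r₁₃ ∘ r'₂₃ = Σ xᵢ ⊗ x'ⱼ ⊗ (yᵢ ∘ y'ⱼ)`. -/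
noncomputable def t1323 (m : A →ₗ[k] A →ₗ[k] A) :
    (A ⊗[k] A) ⊗[k] (A ⊗[k] A) →ₗ[k] (A ⊗[k] A) ⊗[k] A :=
  TensorProduct.map LinearMap.id (TensorProduct.lift m) ∘ₗ
    (TensorProduct.tensorTensorTensorComm k A A A A).toLinearMap

/-- The bilinear operation sending `(r, r')` to `r₁₂ m r'₂₃ = Σ xᵢ ⊗ (yᵢ m x'ⱼ) ⊗ y'ⱼ`. -/
noncomputable def t1223 (m : A →ₗ[k] A →ₗ[k] A) :
    (A ⊗[k] A) ⊗[k] (A ⊗[k] A) →ₗ[k] (A ⊗[k] A) ⊗[k] A :=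
  (TensorProduct.assoc k A A A).symm.toLinearMap ∘ₗ
  TensorProduct.map LinearMap.id
    (TensorProduct.map (TensorProduct.lift m) LinearMap.id ∘ₗ
      (TensorProduct.assoc k A A A).symm.toLinearMap) ∘ₗ
  (TensorProduct.assoc k A A (A ⊗[k] A)).toLinearMap

/-- The bilinear operation sending `(r, r')` to `r₁₃ ∘ r'₁₂ = Σ (xᵢ ∘ x'ⱼ) ⊗ y'ⱼ ⊗ yᵢ`. -/
noncomputable def t1312 (m : A →ₗ[k] A →ₗ[k] A) :
    (A ⊗[k] A) ⊗[k] (A ⊗[k] A) →ₗ[k] (A ⊗[k] A) ⊗[k] A :=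
  (TensorProduct.assoc k A A A).symm.toLinearMap ∘ₗ
  TensorProduct.map (TensorProduct.lift m) (TensorProduct.comm k A A).toLinearMap ∘ₗ
  (TensorProduct.tensorTensorTensorComm k A A A A).toLinearMap

/-- `r₁₃∘r₂₃ + r₁₂⋆r₂₃ + r₁₃∘r₁₂` as an element of `A ⊗ A ⊗ A` (grouping `(A ⊗ A) ⊗ A`). -/
noncomputable def nybeLHS (mulA : A →ₗ[k] A →ₗ[k] A) (r : A ⊗[k] A) : (A ⊗[k] A) ⊗[k] A :=
  t1323 mulA (r ⊗ₜ[k] r) + t1223 (mulA + mulA.flip) (r ⊗ₜ[k] r) + t1312 mulA (r ⊗ₜ[k] r)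

/-- `r` is a solution of the Novikov Yang–Baxter equation in `A`. -/
def IsNYBESolution (mulA : A →ₗ[k] A →ₗ[k] A) (r : A ⊗[k] A) : Prop :=
  nybeLHS mulA r = 0

/-- `r` is a solution of the extended Novikov Yang–Baxter equation of mass `ε` in `A`. -/
def IsENYBESolution (mulA : A →ₗ[k] A →ₗ[k] A) (ε : k) (r : A ⊗[k] A) : Prop :=
  nybeLHS mulA r
    = ε • t1323 mulA ((r + TensorProduct.comm k A A r) ⊗ₜ[k] (r + TensorProduct.comm k A A r))

end DualDefs

section SDDefs
variable {k : Type*} [Field k] [CharZero k]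
variable {A : Type*} [AddCommGroup A] [Module k A]
variable {M : Type*} [AddCommGroup M] [Module k M]

/-- The bilinear product on `A ⊕ M`:
`(a + u) • (b + v) = a∘b + l(a)v + r(b)u + u·v`. -/
noncomputable def sdMul (mulA : A →ₗ[k] A →ₗ[k] A) (mulM : M →ₗ[k] M →ₗ[k] M)
    (l r : A →ₗ[k] Module.End k M) :
    (A × M) →ₗ[k] (A × M) →ₗ[k] (A × M) :=
  LinearMap.mk₂ k
    (fun p q => (mulA p.1 q.1, l p.1 q.2 + r q.1 p.2 + mulM p.2 q.2))
    (fun p p' q => by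
      simp only [Prod.fst_add, Prod.snd_add, map_add, LinearMap.add_apply, Prod.mk_add_mk,
        Prod.mk.injEq]
      exact ⟨trivial, by abel⟩)
    (fun c p q => by
      simp only [Prod.smul_fst, Prod.smul_snd, map_smul, LinearMap.smul_apply, Prod.smul_mk,
        Prod.mk.injEq]
      exact ⟨trivial, by rw [smul_add, smul_add]⟩)
    (fun p q q' => by
      simp only [Prod.fst_add, Prod.snd_add, map_add, LinearMap.add_apply, Prod.mk_add_mk,
        Prod.mk.injEq]
      exact ⟨trivial, by abel⟩)
    (fun c p q => by
      simp only [Prod.smul_fst, Prod.smul_snd, map_smul, LinearMap.smul_apply, Prod.smul_mk,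
        Prod.mk.injEq]
      exact ⟨trivial, by rw [smul_add, smul_add]⟩)

end SDDefs

section SemidirectDual

variable {k : Type*} [Field k]
variable {A : Type*} [AddCommGroup A] [Module k A]
variable {M : Type*} [AddCommGroup M] [Module k M]
variable {V : Type*} [AddCommGroup V] [Module k V]

lemma dualRep_apply_apply (φ : A →ₗ[k] Module.End k M) (a : A) (f : Module.Dual k M) (v : M) :
    dualRep φ a f v = -f (φ a v) := by
  simp [dualRep, Module.Dual.transpose_apply]

lemma negDualRep_apply_apply (φ : A →ₗ[k] Module.End k M) (a : A) (f : Module.Dual k M) (v : M) :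
    negDualRep φ a f v = f (φ a v) := by
  simp [negDualRep, Module.Dual.transpose_apply]

lemma negDualRep_eq_neg_dualRep (φ : A →ₗ[k] Module.End k M) (a : A) (f : Module.Dual k M) :
    negDualRep φ a f = -dualRep φ a f := by
  ext v
  simp [dualRep_apply_apply, negDualRep_apply_apply]

lemma sdMul_apply (mulA : A →ₗ[k] A →ₗ[k] A) (mulM : M →ₗ[k] M →ₗ[k] M)
    (l r : A →ₗ[k] Module.End k M) (x y : A × M) :
    sdMul mulA mulM l r x y = (mulA x.1 y.1, l x.1 y.2 + r y.1 x.2 + mulM x.2 y.2) := rfl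

/-- The product of the semidirect product `A ⋉_{l⋆*, −r*} V*`. -/
noncomputable abbrev dualSdMul (mulA : A →ₗ[k] A →ₗ[k] A) (l r : A →ₗ[k] Module.End k V) :
    (A × Module.Dual k V) →ₗ[k] (A × Module.Dual k V) →ₗ[k] (A × Module.Dual k V) :=
  sdMul mulA 0 (dualRep (l + r)) (negDualRep r)

variable [FiniteDimensional k V]

/-- The `V`-component of an element of `(A ⊕ V*)* ≅ V ⊕ A*`. -/
noncomputable def vecPart : Module.Dual k (A × Module.Dual k V) →ₗ[k] V :=
  (Module.evalEquiv k V).symm.toLinearMap ∘ₗ (LinearMap.inr k A (Module.Dual k V)).dualMap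

lemma apply_vecPart (ξ : Module.Dual k (A × Module.Dual k V)) (p : Module.Dual k V) :
    p (vecPart ξ) = ξ (0, p) := by
  simp [vecPart, Module.apply_evalEquiv_symm_apply]

lemma apply_prod_eq_add_vecPart (ξ : Module.Dual k (A × Module.Dual k V)) (a : A)
    (p : Module.Dual k V) : ξ (a, p) = ξ (a, 0) + p (vecPart ξ) := by
  rw [apply_vecPart, ← map_add, Prod.mk_add_mk, add_zero, zero_add]

lemma vecPart_eq_of_forall {ξ : Module.Dual k (A × Module.Dual k V)} {v : V}
    (h : ∀ p : Module.Dual k V, ξ (0, p) = p v) : vecPart ξ = v := by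
  rw [← sub_eq_zero, ← Module.forall_dual_apply_eq_zero_iff k]
  intro p
  rw [map_sub, apply_vecPart, h, sub_self]

lemma vecPart_surjective :
    Function.Surjective (vecPart : Module.Dual k (A × Module.Dual k V) →ₗ[k] V) := fun v =>
  ⟨Module.Dual.eval k V v ∘ₗ LinearMap.snd k A (Module.Dual k V),
    vecPart_eq_of_forall fun _ => rfl⟩

variable (mulA : A →ₗ[k] A →ₗ[k] A) (l r : A →ₗ[k] Module.End k V)

lemma dualRep_dualSdMul_apply (x : A × Module.Dual k V)
    (η : Module.Dual k (A × Module.Dual k V)) (b : A) (q : Module.Dual k V) :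
    dualRep (dualSdMul mulA l r + (dualSdMul mulA l r).flip) x η (b, q) =
      -η (mulA x.1 b + mulA b x.1, 0) + x.2 (l b (vecPart η)) + q (l x.1 (vecPart η)) := by
  rw [dualRep_apply_apply, LinearMap.add_apply, LinearMap.add_apply, LinearMap.flip_apply,
    sdMul_apply, sdMul_apply, Prod.mk_add_mk, apply_prod_eq_add_vecPart]
  simp [dualRep_apply_apply, negDualRep_apply_apply]
  ring

lemma negDualRep_dualSdMul_flip_apply (x : A × Module.Dual k V)
    (ξ : Module.Dual k (A × Module.Dual k V)) (b : A) (q : Module.Dual k V) :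
    negDualRep (dualSdMul mulA l r).flip x ξ (b, q) =
      ξ (mulA b x.1, 0) - x.2 ((l + r) b (vecPart ξ)) + q (r x.1 (vecPart ξ)) := by
  rw [negDualRep_apply_apply, LinearMap.flip_apply, sdMul_apply, apply_prod_eq_add_vecPart]
  simp [dualRep_apply_apply, negDualRep_apply_apply]
  ring

lemma vecPart_dualRep_dualSdMul (x : A × Module.Dual k V)
    (η : Module.Dual k (A × Module.Dual k V)) :
    vecPart (dualRep (dualSdMul mulA l r + (dualSdMul mulA l r).flip) x η) =
      l x.1 (vecPart η) :=
  vecPart_eq_of_forall fun q => by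
    simp [dualRep_dualSdMul_apply, show η (0, 0) = 0 from map_zero η]

lemma vecPart_negDualRep_dualSdMul_flip (x : A × Module.Dual k V)
    (ξ : Module.Dual k (A × Module.Dual k V)) :
    vecPart (negDualRep (dualSdMul mulA l r).flip x ξ) = r x.1 (vecPart ξ) :=
  vecPart_eq_of_forall fun q => by
    simp [negDualRep_dualSdMul_flip_apply, show ξ (0, 0) = 0 from map_zero ξ]

end SemidirectDual

/-- Transfer of extended O-operators to the semidirect product
`Ã = A ⋉_{l⋆*, −r*} V*`: if `β̃₊` is a balanced `Ã`-bimodule homomorphism, then `α`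
satisfies the extended identity of mass `κ` iff `α̃₋` does on `Ã*`. -/
theorem extendedOOperator_transfer_to_semidirect_product
    {k : Type*} [Field k] [CharZero k]
    {A : Type*} [AddCommGroup A] [Module k A] [FiniteDimensional k A]
    {V : Type*} [AddCommGroup V] [Module k V] [FiniteDimensional k V]
    (mulA : A →ₗ[k] A →ₗ[k] A) (hA : IsNovikov mulA)
    (l r : A →ₗ[k] Module.End k V) (hbm : IsNovikovBimodule mulA l r)
    (α β : V →ₗ[k] A) (κ : k)
    (circT : (A × Module.Dual k V) →ₗ[k] (A × Module.Dual k V) →ₗ[k] (A × Module.Dual k V))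
    (hcircT : circT = sdMul mulA
      (0 : Module.Dual k V →ₗ[k] Module.Dual k V →ₗ[k] Module.Dual k V)
      (dualRep (l + r)) (negDualRep r))
    (at' bt' : Module.Dual k (A × Module.Dual k V) →ₗ[k] (A × Module.Dual k V))
    (hat' : at' = LinearMap.prod
      (α ∘ₗ ((Module.evalEquiv k V).symm.toLinearMap ∘ₗ
        (LinearMap.inr k A (Module.Dual k V)).dualMap))
      (-(α.dualMap ∘ₗ (LinearMap.inl k A (Module.Dual k V)).dualMap)))
    (hbt' : bt' = LinearMap.prod
      (β ∘ₗ ((Module.evalEquiv k V).symm.toLinearMap ∘ₗ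
        (LinearMap.inr k A (Module.Dual k V)).dualMap))
      (β.dualMap ∘ₗ (LinearMap.inl k A (Module.Dual k V)).dualMap))
    (hbal : IsBalanced (dualRep (circT + circT.flip)) (negDualRep circT.flip) bt')
    (hhom : IsBimoduleHom circT (dualRep (circT + circT.flip)) (negDualRep circT.flip) bt') :
    (∀ u v : V,
        mulA (α u) (α v) - α (l (α u) v + r (α v) u) = κ • mulA (β u) (β v)) ↔
    (∀ ξ η : Module.Dual k (A × Module.Dual k V),
        circT (at' ξ) (at' η)
            - at' (dualRep (circT + circT.flip) (at' ξ) η - dualRep circT.flip (at' η) ξ)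
          = κ • circT (bt' ξ) (bt' η)) := by
  have hat1 (ξ) : (at' ξ).1 = α (vecPart ξ) := by rw [hat']; rfl
  have hat2 (ξ) (w : V) : (at' ξ).2 w = -ξ (α w, 0) := by rw [hat']; rfl
  have hbt1 (ξ) : (bt' ξ).1 = β (vecPart ξ) := by rw [hbt']; rfl
  have hbt2 (ξ) (w : V) : (bt' ξ).2 w = ξ (β w, 0) := by rw [hbt']; rfl
  clear hat' hbt'
  obtain rfl : circT = dualSdMul mulA l r := hcircT
  have hl (a : A) (u : V) : β (l a u) = mulA a (β u) := by
    obtain ⟨ξ, rfl⟩ := vecPart_surjective (k := k) (A := A) u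
    have h := congrArg Prod.fst (hhom.1 (a, 0) ξ)
    rwa [hbt1, vecPart_dualRep_dualSdMul, sdMul_apply, hbt1] at h
  have hr (a : A) (u : V) : β (r a u) = mulA (β u) a := by
    obtain ⟨ξ, rfl⟩ := vecPart_surjective (k := k) (A := A) u
    have h := congrArg Prod.fst (hhom.2 (a, 0) ξ)
    rwa [hbt1, vecPart_negDualRep_dualSdMul_flip, sdMul_apply, hbt1] at h
  simp only [sub_eq_add_neg (dualRep _ _ _), ← negDualRep_eq_neg_dualRep]
  have hfst (ξ η) : (at' (dualRep (dualSdMul mulA l r + (dualSdMul mulA l r).flip) (at' ξ) η +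
      negDualRep (dualSdMul mulA l r).flip (at' η) ξ)).1 =
      α (l (α (vecPart ξ)) (vecPart η) + r (α (vecPart η)) (vecPart ξ)) := by
    rw [hat1, map_add, vecPart_dualRep_dualSdMul, vecPart_negDualRep_dualSdMul_flip, hat1, hat1]
  constructor
  · intro h ξ η
    refine Prod.ext ?_ (LinearMap.ext fun w => ?_)
    · rw [Prod.fst_sub, hfst, Prod.smul_fst, sdMul_apply, sdMul_apply]
      simpa only [hat1, hbt1] using h (vecPart ξ) (vecPart η)
    · have e (ζ : Module.Dual k (A × Module.Dual k V)) (u v : V) :=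
        congrArg (fun a => ζ (LinearMap.inl k A (Module.Dual k V) a)) (h u v)
      have e₁ := e ξ w (vecPart η)
      have e₂ := e η (vecPart ξ) w
      have e₃ := e η w (vecPart ξ)
      rw [Prod.snd_sub, LinearMap.sub_apply, hat2, LinearMap.add_apply, dualRep_dualSdMul_apply,
        negDualRep_dualSdMul_flip_apply, Prod.smul_snd, LinearMap.smul_apply, sdMul_apply,
        sdMul_apply]
      have inl_eq (a : A) : ((a, 0) : A × Module.Dual k V) = LinearMap.inl k A _ a := rfl
      simp only [hat1, hbt1, hat2, hbt2, LinearMap.add_apply, LinearMap.zero_apply,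
        dualRep_apply_apply, negDualRep_apply_apply, inl_eq, map_add, map_sub, map_smul, hl, hr,
        smul_eq_mul] at e₁ e₂ e₃ ⊢
      linear_combination e₁ - e₂ - e₃
  · intro h u v
    obtain ⟨ξ, rfl⟩ := vecPart_surjective (k := k) (A := A) u
    obtain ⟨η, rfl⟩ := vecPart_surjective (k := k) (A := A) v
    have h₁ := congrArg Prod.fst (h ξ η)
    rw [Prod.fst_sub, hfst, Prod.smul_fst, sdMul_apply, sdMul_apply] at h₁
    simpa only [hat1, hbt1] using h₁
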